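/- arXiv:2402.12374 — 6 statements merged into one kernel-verified Lean document; each statement's English description precedes it below -/
import Mathlib

section
/- Let T be a token tree and p an acceptance vector. Define the expected number of generated tokens D(T) recursively by: D(T) = 1 + Σ_{i ∈ I} p_i · D(T_i), where I is the set of child indices present at the root of T and T_i is the subtree rooted at the child with index i. Then D(T) = F(T) = Σ_{v ∈ T} f(v), i.e., the expected number of tokens generated by verifying T under the positional acceptance assumption equals the sum of the scores of all nodes of T. -/
/-- A token tree: a finite rooted tree where the children of each node are
labeled by (positive-integer) indices. -/
inductive TokenTree : Type where
  | node : List (ℕ × TokenTree) → TokenTree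

namespace TokenTree

/-- The list of paths (lists of child indices) from the root to each node of the tree. -/
def paths : TokenTree → List (List ℕ)
  | .node cs => [] :: (cs.attach.flatMap (fun it => (paths it.1.2).map (fun l => it.1.1 :: l)))
decreasing_by
  obtain ⟨⟨a, b⟩, hmem⟩ := it
  have := List.sizeOf_lt_of_mem hmem
  simp at this ⊢
  omega

/-- The number of nodes of a token tree. -/
def size (T : TokenTree) : ℕ := T.paths.length

/-- The expected number of generated tokens: the sum over all nodes `v` of the
score `f(v) = ∏_{i ∈ Path(v)} p i`. -/
noncomputable def F (p : ℕ → ℝ) (T : TokenTree) : ℝ :=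
  (T.paths.map (fun l => (l.map p).prod)).sum

/-- The recursively defined expected number of generated tokens:
`D(T) = 1 + ∑_{i ∈ I} p i * D(T_i)`. -/
noncomputable def D (p : ℕ → ℝ) : TokenTree → ℝ
  | .node cs => 1 + (cs.attach.map (fun it => p it.1.1 * D p it.1.2)).sum
decreasing_by
  obtain ⟨⟨a, b⟩, hmem⟩ := it
  have := List.sizeOf_lt_of_mem hmem
  simp at this ⊢
  omega

/-- Well-formedness: child indices are positive and pairwise distinct at every node. -/
inductive WF : TokenTree → Prop
  | node (cs : List (ℕ × TokenTree))
      (hnodup : (cs.map Prod.fst).Nodup)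
      (hpos : ∀ it ∈ cs, 1 ≤ it.1)
      (hrec : ∀ it ∈ cs, WF it.2) : WF (.node cs)

end TokenTree

/-- An acceptance vector: nonnegative entries whose sum over any finite set of
(positive) child indices is at most 1. -/
def IsAcceptanceVector (p : ℕ → ℝ) : Prop :=
  (∀ i, 0 ≤ p i) ∧ ∀ I : Finset ℕ, (∀ i ∈ I, 1 ≤ i) → ∑ i ∈ I, p i ≤ 1

/-- Under the positional acceptance assumption, the recursively
defined expected number of generated tokens `D(T) = 1 + ∑_{i ∈ I} p i * D(T_i)`
equals `F(T) = ∑_{v ∈ T} f(v)`, the sum of the scores of all nodes of `T`. -/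
theorem expected_generated_tokens_eq_sum_scores
    (p : ℕ → ℝ) (hp : IsAcceptanceVector p)
    (T : TokenTree) (hT : T.WF) :
    T.D p = T.F p := by
  induction hT with
  | node cs hnodup hpos hrec ih =>
    have key : ∀ l : List {x // x ∈ cs},
        (l.map (fun it => p it.1.1 * TokenTree.D p it.1.2)).sum =
        ((l.flatMap (fun it => (TokenTree.paths it.1.2).map (fun l => it.1.1 :: l))).map
          (fun l => (l.map p).prod)).sum := by
      intro l
      induction l with
      | nil => simp
      | cons a l ihl =>
        rw [List.map_cons, List.sum_cons, ihl, List.flatMap_cons, List.map_append,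
          List.sum_append, ih a.1 a.2, TokenTree.F, ← List.sum_map_mul_left, List.map_map]
        simp [Function.comp_def]
    rw [TokenTree.D, TokenTree.F, TokenTree.paths, List.map_cons, List.sum_cons, key]
    simp
end

section
/- Fix an integer K ≥ 1 and an acceptance vector p with p_i ≥ 0 for all i. For n ≥ 1 let c(n) be the maximum of F(T) over all token trees T with exactly n nodes in which every node has children only at indices 1, …, K, and set c(0) = 0. Then for every n ≥ 0, c(n+1) = max { 1 + Σ_{i=1}^{K} p_i · c(a_i) : (a₁, …, a_K) ∈ ℕ^K, Σ_{i=1}^{K} a_i = n }. -/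
/-- Every node of the tree has children only at indices `1, …, K`
(upper bound on the child indices). -/
inductive TokenTree.BranchLE (K : ℕ) : TokenTree → Prop
  | node (cs : List (ℕ × TokenTree))
      (hle : ∀ it ∈ cs, it.1 ≤ K)
      (hrec : ∀ it ∈ cs, TokenTree.BranchLE K it.2) : TokenTree.BranchLE K (.node cs)

namespace TokenTree

theorem size_node' (cs : List (ℕ × TokenTree)) :
    size (.node cs) = 1 + (cs.map (fun it => size it.2)).sum := by
  unfold size
  rw [paths]
  have h : cs.attach.flatMap (fun it => (paths it.1.2).map (fun l => it.1.1 :: l))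
      = cs.flatMap (fun it => (paths it.2).map (fun l => it.1 :: l)) := by
    conv_rhs => rw [← List.attach_map_subtype_val cs]
    rw [List.flatMap_map]
  rw [h]
  simp [List.length_flatMap, add_comm]

theorem F_node' (p : ℕ → ℝ) (cs : List (ℕ × TokenTree)) :
    F p (.node cs) = 1 + (cs.map (fun it => p it.1 * F p it.2)).sum := by
  unfold F
  rw [paths]
  have h : cs.attach.flatMap (fun it => (paths it.1.2).map (fun l => it.1.1 :: l))
      = cs.flatMap (fun it => (paths it.2).map (fun l => it.1 :: l)) := by
    conv_rhs => rw [← List.attach_map_subtype_val cs]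
    rw [List.flatMap_map]
  rw [h]
  simp only [List.map_cons, List.map_nil, List.prod_nil, List.sum_cons]
  congr 1
  induction cs with
  | nil => simp
  | cons x xs ih =>
    have ih' := ih (by
      conv_rhs => rw [← List.attach_map_subtype_val xs]
      rw [List.flatMap_map])
    simp only [List.flatMap_cons, List.map_append, List.sum_append, List.map_cons, List.sum_cons,
      ih', List.map_map]
    congr 1
    rw [← List.sum_map_mul_left]
    congr 1
theorem size_pos' (T : TokenTree) : 1 ≤ T.size := by
  cases T with
  | node cs => rw [size_node']; omega

theorem exists_alloc (K : ℕ) (p : ℕ → ℝ) (hp : ∀ i, 0 ≤ p i) (c : ℕ → ℝ) (hc0 : c 0 = 0)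
    (cs : List (ℕ × TokenTree)) (hnd : (cs.map Prod.fst).Nodup)
    (hpos : ∀ it ∈ cs, 1 ≤ it.1) (hle : ∀ it ∈ cs, it.1 ≤ K)
    (hF : ∀ it ∈ cs, F p it.2 ≤ c it.2.size) :
    ∃ a : Fin K → ℕ, (∑ i, a i) = (cs.map (fun it => size it.2)).sum ∧
      (cs.map (fun it => p it.1 * F p it.2)).sum ≤ ∑ i : Fin K, p (i.1 + 1) * c (a i) ∧
      ∀ i : Fin K, i.1 + 1 ∉ cs.map Prod.fst → a i = 0 := by
  induction cs with
  | nil => exact ⟨fun _ => 0, by simp, by simp [hc0], by simp⟩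
  | cons x xs ih =>
    rw [List.map_cons, List.nodup_cons] at hnd
    obtain ⟨a, h1, h2, h3⟩ := ih hnd.2 (fun it h => hpos it (List.mem_cons_of_mem _ h))
      (fun it h => hle it (List.mem_cons_of_mem _ h))
      (fun it h => hF it (List.mem_cons_of_mem _ h))
    have hx1 := hpos x List.mem_cons_self
    have hx2 := hle x List.mem_cons_self
    have hx3 := hF x List.mem_cons_self
    let j : Fin K := ⟨x.1 - 1, by omega⟩
    have hj : j.1 + 1 = x.1 := by simp only [j]; omega
    have haj : a j = 0 := h3 j (by rw [hj]; exact hnd.1)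
    have e1 : ∀ i, Function.update a j x.2.size i = a i + if i = j then x.2.size else 0 := by
      intro i
      by_cases h : i = j
      · subst h; simp [haj]
      · simp [h]
    have e2 : ∀ i : Fin K, p (i.1 + 1) * c (Function.update a j x.2.size i)
        = p (i.1 + 1) * c (a i) + if i = j then p x.1 * c x.2.size else 0 := by
      intro i
      by_cases h : i = j
      · subst h; simp [haj, hc0, hj]
      · simp [h]
    refine ⟨Function.update a j x.2.size, ?_, ?_, ?_⟩
    · simp only [e1, Finset.sum_add_distrib, h1]
      simp [add_comm]
    · simp only [e2, Finset.sum_add_distrib]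
      have := mul_le_mul_of_nonneg_left hx3 (hp x.1)
      simp only [List.map_cons, List.sum_cons, Finset.sum_ite_eq', Finset.mem_univ, if_true]
      linarith
    · intro i hi
      simp only [List.map_cons, List.mem_cons, not_or] at hi
      have : i ≠ j := by
        rintro rfl
        exact hi.1 hj
      rw [Function.update_of_ne this]
      exact h3 i hi.2

theorem sum_filter_map {α M : Type*} [AddCommMonoid M] (L : List α) (q : α → Bool) (f : α → M)
    (h : ∀ x, q x = false → f x = 0) : ((L.filter q).map f).sum = (L.map f).sum := by
  induction L with
  | nil => simp
  | cons x xs ih =>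
    cases hx : q x with
    | true => simp [hx, ih]
    | false => simp [hx, ih, h x hx]

theorem exists_tree (K : ℕ) (p : ℕ → ℝ) (c : ℕ → ℝ) (hc0 : c 0 = 0)
    (hc : ∀ n : ℕ, 1 ≤ n → ∃ T : TokenTree,
        T.WF ∧ T.BranchLE K ∧ T.size = n ∧ c n = T.F p) (a : Fin K → ℕ) :
    ∃ T : TokenTree, T.WF ∧ T.BranchLE K ∧ T.size = (∑ i, a i) + 1 ∧
      1 + ∑ i : Fin K, p (i.1 + 1) * c (a i) = T.F p := by
  have hc' : ∀ n : ℕ, ∃ T : TokenTree, 1 ≤ n →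
        T.WF ∧ T.BranchLE K ∧ T.size = n ∧ c n = T.F p := by
    intro n
    by_cases h : 1 ≤ n
    · obtain ⟨T, hT⟩ := hc n h
      exact ⟨T, fun _ => hT⟩
    · exact ⟨.node [], fun h' => absurd h' h⟩
  choose t ht using hc'
  let L : List (Fin K) := (List.finRange K).filter (fun i => decide (1 ≤ a i))
  have hL : ∀ i ∈ L, 1 ≤ a i := by
    intro i hi
    simpa [L] using hi
  let cs : List (ℕ × TokenTree) := L.map (fun i => (i.1 + 1, t (a i)))
  refine ⟨.node cs, .node cs ?_ ?_ ?_, .node cs ?_ ?_, ?_, ?_⟩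
  · simp only [cs, List.map_map]
    apply List.Nodup.map
    · intro i j hij
      simp only [Function.comp] at hij
      exact Fin.ext (by omega)
    · exact (List.nodup_finRange K).filter _
  · intro it hit
    obtain ⟨i, hi, rfl⟩ := List.mem_map.1 hit
    simp
  · intro it hit
    obtain ⟨i, hi, rfl⟩ := List.mem_map.1 hit
    exact (ht _ (hL i hi)).1
  · intro it hit
    obtain ⟨i, hi, rfl⟩ := List.mem_map.1 hit
    exact i.2
  · intro it hit
    obtain ⟨i, hi, rfl⟩ := List.mem_map.1 hit
    exact (ht _ (hL i hi)).2.1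
  · rw [size_node', add_comm]
    congr 1
    have : (cs.map (fun it => size it.2)) = L.map a := by
      simp only [cs, List.map_map]
      apply List.map_congr_left
      intro i hi
      exact (ht _ (hL i hi)).2.2.1
    rw [this, sum_filter_map]
    · exact (Fin.sum_univ_def a).symm
    · intro i hi
      simpa using hi
  · rw [F_node']
    congr 1
    have : (cs.map (fun it => p it.1 * F p it.2))
        = L.map (fun i : Fin K => p (i.1 + 1) * c (a i)) := by
      simp only [cs, List.map_map]
      apply List.map_congr_left
      intro i hi
      simp only [Function.comp]
      rw [(ht _ (hL i hi)).2.2.2]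
    rw [this, sum_filter_map]
    · exact Fin.sum_univ_def _
    · intro i hi
      have : a i = 0 := by simpa using hi
      simp [this, hc0]

end TokenTree

/-- If `c n` is the maximum of `F(T)` over token trees with exactly
`n` nodes whose children appear only at indices `1, …, K`, and `c 0 = 0`, then
`c (n+1)` is the maximum of `1 + ∑_{i=1}^{K} p_i * c (a_i)` over all tuples
`(a₁, …, a_K) ∈ ℕ^K` with `∑ a_i = n`. -/
theorem sequoia_dp_recursion
    (K : ℕ) (hK : 1 ≤ K)
    (p : ℕ → ℝ) (hp : IsAcceptanceVector p)
    (c : ℕ → ℝ) (hc0 : c 0 = 0)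
    (hc : ∀ n : ℕ, 1 ≤ n →
      IsGreatest {x : ℝ | ∃ T : TokenTree,
        T.WF ∧ T.BranchLE K ∧ T.size = n ∧ x = T.F p} (c n)) :
    ∀ n : ℕ,
      IsGreatest {x : ℝ | ∃ a : Fin K → ℕ, (∑ i, a i) = n ∧
        x = 1 + ∑ i : Fin K, p (i.1 + 1) * c (a i)} (c (n + 1)) := by
  intro n
  have hc' : ∀ n : ℕ, 1 ≤ n → ∃ T : TokenTree,
        T.WF ∧ T.BranchLE K ∧ T.size = n ∧ c n = T.F p := fun n hn => (hc n hn).1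
  have hub : ∀ a : Fin K → ℕ, (∑ i, a i) = n →
      1 + ∑ i : Fin K, p (i.1 + 1) * c (a i) ≤ c (n + 1) := by
    intro a ha
    obtain ⟨T, h1, h2, h3, h4⟩ := TokenTree.exists_tree K p c hc0 hc' a
    exact (hc (n + 1) (by omega)).2 ⟨T, h1, h2, by rw [h3, ha], h4⟩
  constructor
  · obtain ⟨T, h1, h2, h3, h4⟩ := hc' (n + 1) (by omega)
    cases h1 with
    | node cs hnd hpos hrec =>
      cases h2 with
      | node _ hle hrec2 =>
        obtain ⟨a, ha1, ha2, -⟩ := TokenTree.exists_alloc K p hp.1 c hc0 cs hnd hpos hle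
          (fun it hit => (hc _ (TokenTree.size_pos' it.2)).2
            ⟨it.2, hrec it hit, hrec2 it hit, rfl, rfl⟩)
        rw [TokenTree.size_node'] at h3
        rw [TokenTree.F_node'] at h4
        have hs : (∑ i, a i) = n := by omega
        exact ⟨a, hs, le_antisymm (by linarith) (hub a hs)⟩
  · rintro x ⟨a, ha, rfl⟩
    exact hub a ha
end

section
/- Let b > 0 be a real number and let p be an acceptance vector that has a b power-law acceptance rate, i.e., for every integer k ≥ 1, Σ_{i=1}^{k} p_i ≥ 1 − 1/k^b. Then there exists N ∈ ℕ such that for all n ≥ N, the maximum of F(T) over all token trees T with at most n nodes is at least b·log(n) / (10·log(log(n))). In particular, the expected number of tokens G(n) generated by verifying the Sequoia tree of size n is in Ω(b·log(n)/log(log(n))). -/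
namespace TokenTree

theorem paths_node' (cs : List (ℕ × TokenTree)) :
    paths (.node cs) = [] :: (cs.flatMap (fun it => (paths it.2).map (fun l => it.1 :: l))) := by
  rw [paths]
  congr 1
  have h := List.flatMap_subtype (l := cs.attach)
    (f := fun it => (paths it.1.2).map (fun l => it.1.1 :: l))
    (g := fun it => (paths it.2).map (fun l => it.1 :: l)) (fun _ _ => rfl)
  rw [h]
  simp

/-- The complete `k`-ary tree of depth `d`. -/
def full (k : ℕ) : ℕ → TokenTree
  | 0 => .node []
  | d + 1 => .node ((List.range k).map (fun i => (i + 1, full k d)))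

theorem full_wf (k d : ℕ) : (full k d).WF := by
  induction d with
  | zero => exact WF.node [] (by simp) (by simp) (by simp)
  | succ d ih =>
    refine WF.node _ ?_ ?_ ?_
    · rw [List.map_map]
      refine List.Nodup.map ?_ List.nodup_range
      intro a b h
      simpa using h
    · intro it hit
      obtain ⟨i, -, rfl⟩ := List.mem_map.1 hit
      simp
    · intro it hit
      obtain ⟨i, -, rfl⟩ := List.mem_map.1 hit
      exact ih

theorem size_full_zero (k : ℕ) : (full k 0).size = 1 := by
  simp [full, size, paths_node']

theorem size_full_succ (k d : ℕ) : (full k (d + 1)).size = 1 + k * (full k d).size := by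
  simp [full, size, paths_node', List.length_flatMap, List.map_map, Function.comp_def, add_comm]

theorem size_full_le (k d : ℕ) : 1 ≤ (full k d).size ∧ (full k d).size ≤ (k + 1) ^ d := by
  induction d with
  | zero => simp [size_full_zero]
  | succ d ih =>
    rw [size_full_succ, pow_succ]
    constructor <;> nlinarith

theorem F_full_zero (p : ℕ → ℝ) (k : ℕ) : (full k 0).F p = 1 := by
  simp [full, F, paths_node']

theorem sum_flatMap_aux {α β : Type} (f : α → List β) (g : β → ℝ) (l : List α) :
    ((l.flatMap f).map g).sum = (l.map (fun a => ((f a).map g).sum)).sum := by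
  induction l with
  | nil => simp
  | cons a l ih => simp [ih]

theorem F_full_succ (p : ℕ → ℝ) (k d : ℕ) :
    (full k (d + 1)).F p = 1 + (∑ i ∈ Finset.Icc 1 k, p i) * (full k d).F p := by
  have h : ∑ i ∈ Finset.Icc 1 k, p i = ∑ i ∈ Finset.range k, p (i + 1) := by
    rw [Finset.range_eq_Ico, Finset.sum_Ico_add' p 0 k 1]
    rfl
  rw [h, Finset.sum_mul]
  simp only [full, F, paths_node', List.map_cons, List.sum_cons, List.map_nil, List.prod_nil,
    sum_flatMap_aux, List.map_map, Function.comp_def, List.prod_cons, List.sum_map_mul_left]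
  congr 1

theorem F_full_ge (p : ℕ → ℝ) (k d : ℕ) (ε : ℝ) (h0 : 0 ≤ ε) (h1 : ε ≤ 1)
    (h : 1 - ε ≤ ∑ i ∈ Finset.Icc 1 k, p i) :
    0 ≤ (full k d).F p ∧ ((d : ℝ) + 1) * (1 - d * ε) ≤ (full k d).F p := by
  induction d with
  | zero => simp [F_full_zero]
  | succ d ih =>
    obtain ⟨i0, i1⟩ := ih
    rw [F_full_succ]
    have a1 := mul_le_mul_of_nonneg_right h i0
    have a2 := mul_le_mul_of_nonneg_left i1 (sub_nonneg.2 h1)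
    have a3 : 0 ≤ (1 - ε) * (full k d).F p := mul_nonneg (by linarith) i0
    refine ⟨by linarith, ?_⟩
    have hd : (0 : ℝ) ≤ d := Nat.cast_nonneg d
    push_cast
    have a4 : 0 ≤ (d + 1) * d * ε ^ 2 := by positivity
    have a5 : 0 ≤ (d + 1) * ε := by positivity
    nlinarith

end TokenTree

/-- If the acceptance vector has a `b` power-law acceptance rate
(`∑_{i=1}^{k} p_i ≥ 1 − 1/k^b` for all `k ≥ 1`), then for all sufficiently large `n`
the maximum of `F(T)` over token trees with at most `n` nodes is at least
`b·log(n) / (10·log(log(n)))`; i.e. the expected number of tokens generated by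
verifying the Sequoia tree of size `n` is in `Ω(b·log n / log log n)`. -/
theorem sequoia_tree_scalability
    (b : ℝ) (hb : 0 < b)
    (p : ℕ → ℝ) (hp : IsAcceptanceVector p)
    (hpow : ∀ k : ℕ, 1 ≤ k → 1 - 1 / (k : ℝ) ^ b ≤ ∑ i ∈ Finset.Icc 1 k, p i) :
    ∃ N : ℕ, ∀ n : ℕ, N ≤ n →
      ∃ T : TokenTree, T.WF ∧ T.size ≤ n ∧
        b * Real.log n / (10 * Real.log (Real.log n)) ≤ T.F p := by
  have t1 : Filter.Tendsto (fun n : ℕ => Real.log (n : ℝ)) Filter.atTop Filter.atTop :=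
    Real.tendsto_log_atTop.comp tendsto_natCast_atTop_atTop
  have t2 := Real.tendsto_log_atTop.comp t1
  obtain ⟨N, hN⟩ := Filter.eventually_atTop.1
    (((t1.eventually_ge_atTop 1).and (t2.eventually_ge_atTop (2 * b))).and
      (t2.eventually_ge_atTop 1))
  refine ⟨N, fun n hn => ?_⟩
  obtain ⟨⟨hL, hb2⟩, hl1⟩ := hN n hn
  simp only [Function.comp] at hb2 hl1
  have hn0 : (0 : ℝ) < n := by
    rcases Nat.eq_zero_or_pos n with h | h
    · subst h; norm_num at hL
    · exact_mod_cast h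
  set L := Real.log (n : ℝ) with hLdef
  set l := Real.log L with hldef
  have hLpos : 0 < L := by linarith
  set x := Real.exp (l / b) with hx
  have hx2 : Real.exp 2 ≤ x := Real.exp_le_exp.2 (by rw [le_div_iff₀ hb]; linarith)
  have hx3 : 3 ≤ x := by
    have := Real.add_one_le_exp (2 : ℝ)
    linarith
  set k := ⌈x⌉₊ with hk
  have hkx : x ≤ k := Nat.le_ceil x
  have hkx2 : (k : ℝ) < x + 1 := Nat.ceil_lt_add_one (by linarith)
  have hk1 : 1 ≤ k := by
    have : (1 : ℝ) ≤ k := by linarith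
    exact_mod_cast this
  have hkb : L ≤ (k : ℝ) ^ b := by
    calc L = x ^ b := by
          rw [hx, ← Real.exp_mul, div_mul_cancel₀ _ hb.ne', hldef, Real.exp_log hLpos]
      _ ≤ (k : ℝ) ^ b := Real.rpow_le_rpow (by linarith) hkx hb.le
  set g := Real.log ((k : ℝ) + 1) with hg
  have hg2 : 2 ≤ g := by
    rw [hg, Real.le_log_iff_exp_le (by linarith)]
    linarith
  have hgl : g ≤ 2 * (l / b) := by
    rw [hg, Real.log_le_iff_le_exp (by linarith), two_mul, Real.exp_add, ← hx]
    nlinarith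
  set d := ⌊L / g⌋₊ with hd
  have hd1 : (d : ℝ) ≤ L / g := Nat.floor_le (by positivity)
  have hd2 : L / g < d + 1 := Nat.lt_floor_add_one _
  have hS : 1 - 1 / L ≤ ∑ i ∈ Finset.Icc 1 k, p i := by
    have h1 := hpow k hk1
    have h2 : 1 / (k : ℝ) ^ b ≤ 1 / L := one_div_le_one_div_of_le hLpos hkb
    linarith
  refine ⟨TokenTree.full k d, TokenTree.full_wf k d, ?_, ?_⟩
  · refine (TokenTree.size_full_le k d).2.trans ?_
    have h1 : (d : ℝ) * g ≤ L := (le_div_iff₀ (by linarith)).1 hd1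
    have h2 : ((k : ℝ) + 1) ^ d ≤ n := by
      rw [← Real.log_le_log_iff (by positivity) hn0, Real.log_pow]
      exact h1
    exact_mod_cast h2
  · have hF := (TokenTree.F_full_ge p k d (1 / L) (by positivity)
      (by rw [div_le_one hLpos]; exact hL) hS).2
    have e1 : (d : ℝ) * (1 / L) ≤ 1 / 2 := by
      have : (d : ℝ) * g ≤ L := (le_div_iff₀ (by linarith)).1 hd1
      have hd0 : (0 : ℝ) ≤ d := Nat.cast_nonneg d
      rw [mul_one_div, div_le_iff₀ hLpos]
      nlinarith
    have e2 : b * L / (2 * l) ≤ L / g := by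
      rw [div_le_div_iff₀ (by linarith) (by linarith)]
      have : g * b ≤ 2 * l := by
        have h3 := mul_le_mul_of_nonneg_right hgl hb.le
        rwa [mul_assoc, div_mul_cancel₀ _ hb.ne'] at h3
      nlinarith
    have e3 : b * L / (10 * l) = (1 / 5) * (b * L / (2 * l)) := by
      field_simp
      norm_num
    have e4 : 0 ≤ b * L / (2 * l) := by positivity
    rw [e3]
    have hd0 : (0 : ℝ) ≤ d := Nat.cast_nonneg d
    nlinarith
end

section
/- Let b > 0 be a real number and let n be a real number with n ≥ exp((1 + exp(2^{b+1}/log(1.9)))^b). Set k = ⌊(log n)^{1/b}⌋ and let d be the largest natural number with (k^{d+1} − 1)/(k − 1) ≤ n (the number of nodes of a full k-ary tree of depth d is at most n). Then for every real r with 0 < r ≤ 1/k^b, the quantity (1 − (1 − r)^{d+1})/r satisfies (1 − (1 − r)^{d+1})/r ≥ b·log(n) / (10·log(log(n))). -/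
/-- For `b > 0` and `n ≥ exp((1 + exp(2^{b+1}/log 1.9))^b)`, setting
`k = ⌊(log n)^{1/b}⌋` and letting `d` be the largest natural number with
`(k^{d+1} − 1)/(k − 1) ≤ n`, every rejection probability `r` with `0 < r ≤ 1/k^b`
satisfies `(1 − (1 − r)^{d+1})/r ≥ b·log(n) / (10·log(log(n)))`. -/
theorem kary_tree_expected_length_lower_bound
    (b : ℝ) (hb : 0 < b)
    (n : ℝ) (hn : Real.exp ((1 + Real.exp ((2 : ℝ) ^ (b + 1) / Real.log 1.9)) ^ b) ≤ n)
    (k : ℕ) (hk : k = ⌊Real.log n ^ (1 / b)⌋₊)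
    (d : ℕ) (hd : IsGreatest {m : ℕ | ((k : ℝ) ^ (m + 1) - 1) / ((k : ℝ) - 1) ≤ n} d)
    (r : ℝ) (hr0 : 0 < r) (hr1 : r ≤ 1 / (k : ℝ) ^ b) :
    b * Real.log n / (10 * Real.log (Real.log n)) ≤ (1 - (1 - r) ^ (d + 1)) / r := by
  set C : ℝ := (2 : ℝ) ^ (b + 1) / Real.log 1.9 with hC
  have hl0 : 0 < Real.log 1.9 := Real.log_pos (by norm_num)
  have hl1 : Real.log 1.9 ≤ 0.9 := by
    have := Real.log_le_sub_one_of_pos (show (0 : ℝ) < 1.9 by norm_num)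
    linarith
  have h2b : (1 : ℝ) ≤ 2 ^ b := Real.one_le_rpow (by norm_num) hb.le
  have hC2 : 2 * (2 : ℝ) ^ b ≤ C := by
    rw [hC, le_div_iff₀ hl0, Real.rpow_add (by norm_num), Real.rpow_one]
    nlinarith
  have hexpC : C + 1 ≤ Real.exp C := Real.add_one_le_exp C
  have hbase : (0 : ℝ) < 1 + Real.exp C := by positivity
  have hnpos : 0 < n := lt_of_lt_of_le (Real.exp_pos _) hn
  have hL : (1 + Real.exp C) ^ b ≤ Real.log n := (Real.le_log_iff_exp_le hnpos).2 hn
  have hL1 : 1 ≤ Real.log n :=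
    le_trans (Real.one_le_rpow (by linarith) hb.le) hL
  generalize hLdef : Real.log n = L at *
  set x : ℝ := L ^ (1 / b) with hx
  have hL0 : 0 < L := by linarith
  have hxb : x ^ b = L := by
    rw [hx, ← Real.rpow_mul hL0.le, one_div_mul_cancel hb.ne', Real.rpow_one]
  have hx0 : 0 < x := Real.rpow_pos_of_pos hL0 _
  have hxC : 1 + Real.exp C ≤ x := by
    rw [← hxb] at hL
    exact (Real.rpow_le_rpow_iff hbase.le hx0.le hb).1 hL
  have hlogL : Real.log L = b * Real.log x := by
    rw [← hxb, Real.log_rpow hx0]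
  have hkx : (k : ℝ) ≤ x := by rw [hk]; exact Nat.floor_le hx0.le
  have hxk : x < k + 1 := by rw [hk]; exact Nat.lt_floor_add_one x
  have hk3 : (3 : ℝ) ≤ k := by linarith
  have hk0 : (0 : ℝ) < k := by linarith
  have hlogx : C ≤ Real.log x := (Real.le_log_iff_exp_le hx0).2 (by linarith)
  have hlogx0 : 0 < Real.log x := by linarith
  have hkb : L ≤ 2 ^ b * (k : ℝ) ^ b := by
    rw [← hxb, ← Real.mul_rpow (by norm_num) hk0.le]
    exact Real.rpow_le_rpow hx0.le (by linarith) hb.le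
  have hkb1 : (1 : ℝ) ≤ (k : ℝ) ^ b := Real.one_le_rpow (by linarith) hb.le
  have hrk : r * (k : ℝ) ^ b ≤ 1 := (le_div_iff₀ (by linarith)).1 hr1
  have hr1' : r ≤ 1 := by nlinarith
  -- depth bound
  have hnot : n < ((k : ℝ) ^ (d + 1 + 1) - 1) / ((k : ℝ) - 1) := by
    by_contra h
    have := hd.2 (show d + 1 ∈ _ from not_lt.1 h)
    omega
  have hk1 : (0 : ℝ) < k - 1 := by linarith
  rw [lt_div_iff₀ hk1] at hnot
  have hlog : L + Real.log ((k : ℝ) - 1) ≤ (d + 2) * Real.log k := by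
    have h := Real.log_le_log (by positivity)
      (show n * ((k : ℝ) - 1) ≤ (k : ℝ) ^ (d + 1 + 1) by linarith)
    rw [Real.log_mul hnpos.ne' hk1.ne', hLdef, Real.log_pow] at h
    push_cast at h
    linarith
  have hlogk1 : Real.log k - 1 / 2 ≤ Real.log ((k : ℝ) - 1) := by
    have h := Real.log_le_sub_one_of_pos (show (0 : ℝ) < k / (k - 1) by positivity)
    rw [Real.log_div hk0.ne' hk1.ne'] at h
    have h2 : (k : ℝ) / (k - 1) ≤ 3 / 2 := by
      rw [div_le_iff₀ hk1]; linarith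
    linarith
  have hlogkx : Real.log k ≤ Real.log x := Real.log_le_log hk0 hkx
  have hD : L ≤ 2 * (((d : ℝ) + 1) * Real.log x) := by
    have : ((d : ℝ) + 1) * Real.log k ≤ ((d : ℝ) + 1) * Real.log x := by gcongr
    linarith
  -- expected length bound
  set D : ℝ := (d : ℝ) + 1 with hDdef
  have hD0 : 0 < D := by positivity
  have hpow : (1 - r) ^ (d + 1) * (1 + r * D) ≤ 1 := by
    have h1 : (1 - r) ^ (d + 1) ≤ Real.exp (-(r * D)) := by
      have h := pow_le_pow_left₀ (by linarith) (Real.one_sub_le_exp_neg r) (d + 1)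
      rw [← Real.exp_nat_mul] at h
      refine h.trans (le_of_eq ?_)
      congr 1
      push_cast
      rw [hDdef]; ring
    have h2 : 1 + r * D ≤ Real.exp (r * D) := by
      have := Real.add_one_le_exp (r * D); linarith
    calc (1 - r) ^ (d + 1) * (1 + r * D)
        ≤ Real.exp (-(r * D)) * Real.exp (r * D) := by gcongr
      _ = 1 := by rw [← Real.exp_add]; simp
  have hE : D / (1 + r * D) ≤ (1 - (1 - r) ^ (d + 1)) / r := by
    rw [div_le_div_iff₀ (by positivity) hr0]
    linarith
  refine le_trans ?_ hE
  have hlhs : b * L / (10 * Real.log L) = L / (10 * Real.log x) := by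
    rw [hlogL]; field_simp
  rw [hlhs, div_le_div_iff₀ (by positivity) (by positivity)]
  have hrL : r * L ≤ Real.log x := by
    have h1 : r * L ≤ r * (2 ^ b * (k : ℝ) ^ b) := by gcongr
    have h2 : (2 : ℝ) ^ b * (r * (k : ℝ) ^ b) ≤ 2 ^ b * 1 := by gcongr
    linarith
  have h3 : D * (r * L) ≤ D * Real.log x := by gcongr
  nlinarith [mul_pos hD0 hlogx0]
end

section
/- Let V be a finite type, let P : V → ℝ be nonnegative with Σ_x P(x) = 1, and let j ≥ 0. Suppose R : ℕ → V → ℝ, D : ℕ → V → ℝ, and x : ℕ → V satisfy: R(0) = P; each D(i) is nonnegative; for every i < j, S_i := Σ_y max(0, R(i)(y) − D(i)(y)) > 0 and R(i+1)(y) = max(0, R(i)(y) − D(i)(y))/S_i for all y; and for every i < j, R(i)(x(i)) < D(i)(x(i)) (token x(i) was rejected at iteration i). Then: (a) for every i < j, R(j)(x(i)) = 0, and (b) the support of R(j) is contained in the support of P. That is, the support of the residual distribution never grows, and every rejected token is excluded from all subsequent residuals. -/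
/-- In Sequoia's residual updates, once a token is rejected it is
excluded from all subsequent residuals, and the support of the residual never grows:
`R j (x i) = 0` for all `i < j`, and `support (R j) ⊆ support P`. -/
theorem residual_support_shrinks
    (V : Type*) [Fintype V] (P : V → ℝ)
    (hP : ∀ y, 0 ≤ P y) (hPsum : ∑ y, P y = 1)
    (j : ℕ) (R D : ℕ → V → ℝ) (x : ℕ → V)
    (hR0 : R 0 = P)
    (hD : ∀ i y, 0 ≤ D i y)
    (hS : ∀ i < j, 0 < ∑ y, max 0 (R i y - D i y))
    (hstep : ∀ i < j, ∀ y,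
      R (i + 1) y = max 0 (R i y - D i y) / ∑ z, max 0 (R i z - D i z))
    (hrej : ∀ i < j, R i (x i) < D i (x i)) :
    (∀ i < j, R j (x i) = 0) ∧
      Function.support (R j) ⊆ Function.support P := by
  have hz : ∀ i < j, ∀ y, R i y ≤ D i y → R (i + 1) y = 0 := by
    intro i hi y h
    rw [hstep i hi y, max_eq_left (by linarith), zero_div]
  have key : ∀ y k m, k ≤ m → m ≤ j → R k y = 0 → R m y = 0 := by
    intro y k m hkm
    induction m, hkm using Nat.le_induction with
    | base => intro _ h; exact h
    | succ m hm ih =>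
      intro hmj h
      apply hz m (by omega) y
      rw [ih (by omega) h]
      exact hD m y
  refine ⟨fun i hi => key (x i) (i + 1) j hi le_rfl (hz i hi _ (hrej i hi).le), ?_⟩
  intro y hy h0
  exact hy (key y 0 j (Nat.zero_le _) le_rfl (by rw [hR0]; exact h0))
end

section
/- Let p be an acceptance vector, let k ≥ 1 and L ≥ 1 be integers, and let T be the token tree consisting of a root with k children at indices 1, …, k, where each child is the first node of a chain of L nodes in which every subsequent node is the child at index 1 of its predecessor (i.e., k independent sequences of length L branching from the root). Then F(T) = 1 + (Σ_{i=1}^{k} p_i)·(Σ_{j=0}^{L−1} p₁^j). Consequently, if p₁ < 1, then F(T) ≤ 1 + P_k/(1 − P₁), where P₁ = p₁ and P_k = Σ_{i=1}^{k} p_i; so the expected number of generated tokens for k independent sequences is bounded above by 1 + P_k/(1 − P₁), uniformly in L. -/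
/-- A chain of `L` nodes (for `L ≥ 1`) in which every subsequent node is the
child at index 1 of its predecessor. -/
def chainTree : ℕ → TokenTree
  | 0 => .node []
  | 1 => .node []
  | (L + 2) => .node [(1, chainTree (L + 1))]

theorem TokenTree.F_node (p : ℕ → ℝ) (cs : List (ℕ × TokenTree)) :
    TokenTree.F p (TokenTree.node cs)
      = 1 + (cs.map (fun it => p it.1 * TokenTree.F p it.2)).sum := by
  have h : (TokenTree.node cs).paths
      = [] :: cs.flatMap (fun it => (TokenTree.paths it.2).map (fun l => it.1 :: l)) := by
    rw [TokenTree.paths]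
    congr 1
    rw [List.flatMap_subtype
      (g := fun it : ℕ × TokenTree => (TokenTree.paths it.2).map (fun l => it.1 :: l))
      (fun _ _ => rfl)]
    simp
  unfold TokenTree.F
  rw [h, List.map_cons, List.sum_cons]
  simp only [List.map_nil, List.prod_nil]
  congr 1
  clear h
  induction cs with
  | nil => simp
  | cons a t ih =>
    rw [List.flatMap_cons, List.map_append, List.sum_append, ih, List.map_cons, List.sum_cons]
    congr 1
    rw [List.map_map, ← List.sum_map_mul_left]
    simp [Function.comp_def]

theorem F_chainTree (p : ℕ → ℝ) (L : ℕ) :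
    TokenTree.F p (chainTree (L + 1)) = ∑ j ∈ Finset.range (L + 1), p 1 ^ j := by
  induction L with
  | zero => simp [chainTree, TokenTree.F_node]
  | succ n ih =>
    rw [chainTree, TokenTree.F_node, Finset.sum_range_succ']
    simp only [List.map_cons, List.map_nil, List.sum_cons, List.sum_nil, ih, pow_succ,
      ← Finset.sum_mul]
    ring

/-- For the token tree consisting of a root with `k` children at
indices `1, …, k`, each heading a chain of `L` nodes linked via index 1
(`k` independent sequences of length `L`), we have
`F(T) = 1 + (∑_{i=1}^k p_i)·(∑_{j=0}^{L−1} p₁^j)`; consequently, if `p₁ < 1`,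
then `F(T) ≤ 1 + P_k/(1 − P₁)`, uniformly in `L`. -/
theorem k_independent_sequences_bound
    (p : ℕ → ℝ) (hp : IsAcceptanceVector p)
    (k L : ℕ) (hk : 1 ≤ k) (hL : 1 ≤ L) :
    TokenTree.F p
        (TokenTree.node ((List.range k).map (fun i => (i + 1, chainTree L))))
      = 1 + (∑ i ∈ Finset.Icc 1 k, p i) * (∑ j ∈ Finset.range L, p 1 ^ j) ∧
    (p 1 < 1 →
      TokenTree.F p
          (TokenTree.node ((List.range k).map (fun i => (i + 1, chainTree L))))
        ≤ 1 + (∑ i ∈ Finset.Icc 1 k, p i) / (1 - p 1)) := by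
  have key : TokenTree.F p
        (TokenTree.node ((List.range k).map (fun i => (i + 1, chainTree L))))
      = 1 + (∑ i ∈ Finset.Icc 1 k, p i) * (∑ j ∈ Finset.range L, p 1 ^ j) := by
    obtain ⟨m, rfl⟩ : ∃ m, L = m + 1 := ⟨L - 1, by omega⟩
    rw [TokenTree.F_node, List.map_map]
    congr 1
    simp only [Function.comp_def, F_chainTree]
    rw [List.sum_map_mul_right]
    congr 1
    clear hk
    induction k with
    | zero => simp
    | succ n ih =>
      rw [List.range_succ, List.map_append, List.sum_append, ih,
        Finset.sum_Icc_succ_top (by omega)]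
      simp
  refine ⟨key, fun h1 => ?_⟩
  rw [key, div_eq_mul_inv]
  have hpos : 0 < 1 - p 1 := by linarith
  have hg : ∑ j ∈ Finset.range L, p 1 ^ j ≤ (1 - p 1)⁻¹ := by
    rw [← one_div, le_div_iff₀ hpos, geom_sum_mul_neg]
    linarith [pow_nonneg (hp.1 1) L]
  have hs : 0 ≤ ∑ i ∈ Finset.Icc 1 k, p i := Finset.sum_nonneg fun i _ => hp.1 i
  linarith [mul_le_mul_of_nonneg_left hg hs]
end
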